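/- arXiv:1806.00714 — 2 statements merged into one kernel-verified Lean document; each statement's English description precedes it below -/
import Mathlib

section
/- For every pair of integers (a, b), define the element c_{a,b} of ℚ(t) by c_{a,b} = Σ_{n≥1} n · ([z^{a−n}] P_n(z)^{−1}) · ([w^{b+n}] Q_n(w)) − Σ_{m≥1} m · ([w^{b−m}] P_m(w)^{−1}) · ([z^{a+m}] Q_m(z)); in each sum all but finitely many terms vanish (the first sum has no nonzero terms with n > a, the second none with m > b). Then c_{a,b} = (−1)^{a−1}·t if a + b = 1, and c_{a,b} = 0 otherwise. (This is the coefficient-wise form of the formal distribution identity Σ_{n≠0} n (z/w)^n /((1+tz)_n (1+tw)_{−n}) = tz · Σ_{n∈ℤ} (−z/w)^n, which is the scalar content of the commutation relation [𝒜̃_k, 𝒜̃_l] = ±δ_{k+l−1} t/u² for the operators 𝒜̃_k at u = 1.) -/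
/-!
STATEMENT 2: coefficient-wise form of the formal distribution identity
`Σ_{n≠0} n (z/w)^n /((1+tz)_n (1+tw)_{−n}) = t z · Σ_{n∈ℤ} (−z/w)^n`
over `ℚ(t)`.
-/

noncomputable section

abbrev K₂ : Type := RatFunc ℚ

/-- the indeterminate `t` of `ℚ(t)`. -/
def tv : K₂ := RatFunc.X

/-- `P n = (1+tz)_n = ∏_{j=1}^n (tz + j)`, as a power series in `z` over `ℚ(t)`. -/
def P (n : ℕ) : PowerSeries K₂ :=
  ∏ j ∈ Finset.range n,
    (PowerSeries.C tv * PowerSeries.X + PowerSeries.C ((j : K₂) + 1))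

/-- `Q n = ∏_{j=0}^{n-1} (tw − j)`, a polynomial of degree `n` in `w` over `ℚ(t)`. -/
def Q (n : ℕ) : Polynomial K₂ :=
  ∏ j ∈ Finset.range n, (Polynomial.C tv * Polynomial.X - Polynomial.C (j : K₂))

/-- Coefficient extraction with integer index for power series
(zero for negative index). -/
def psCoeff (r : ℤ) (f : PowerSeries K₂) : K₂ :=
  if 0 ≤ r then PowerSeries.coeff r.toNat f else 0

/-- Coefficient extraction with integer index for polynomials
(zero for negative index). -/
def polCoeff (r : ℤ) (p : Polynomial K₂) : K₂ :=
  if 0 ≤ r then p.coeff r.toNat else 0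

/-- The first summand `n · [z^{a−n}] P_n^{−1} · [w^{b+n}] Q_n`. -/
def term₁ (a b : ℤ) (n : ℕ) : K₂ :=
  (n : K₂) * psCoeff (a - n) (P n)⁻¹ * polCoeff (b + n) (Q n)

/-- The second summand `m · [w^{b−m}] P_m^{−1} · [z^{a+m}] Q_m`. -/
def term₂ (a b : ℤ) (m : ℕ) : K₂ :=
  (m : K₂) * psCoeff (b - m) (P m)⁻¹ * polCoeff (a + m) (Q m)

/-- `c_{a,b}` (the `n = 0` and `m = 0` terms vanish because of the factor `n`,
so the sums over `n, m ≥ 1` may be taken over all of `ℕ`; they have finite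
support). -/
def c (a b : ℤ) : K₂ := (∑ᶠ n : ℕ, term₁ a b n) - (∑ᶠ m : ℕ, term₂ a b m)

theorem psCoeff_of_neg {r : ℤ} (hr : r < 0) (f : PowerSeries K₂) : psCoeff r f = 0 :=
  if_neg (by omega)

theorem polCoeff_of_neg {r : ℤ} (hr : r < 0) (p : Polynomial K₂) : polCoeff r p = 0 :=
  if_neg (by omega)

theorem psCoeff_one (r : ℤ) : psCoeff r 1 = if r = 0 then 1 else 0 := by
  rcases lt_or_ge r 0 with hr | hr
  · rw [psCoeff_of_neg hr, if_neg hr.ne]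
  · lift r to ℕ using hr
    simp [psCoeff, PowerSeries.coeff_one]

theorem polCoeff_one (r : ℤ) : polCoeff r 1 = if r = 0 then 1 else 0 := by
  rcases lt_or_ge r 0 with hr | hr
  · rw [polCoeff_of_neg hr, if_neg hr.ne]
  · lift r to ℕ using hr
    simp [polCoeff, Polynomial.coeff_one]

theorem psCoeff_mul_linear (r : ℤ) (f : PowerSeries K₂) (u v : K₂) :
    psCoeff r (f * (PowerSeries.C u * PowerSeries.X + PowerSeries.C v)) =
      u * psCoeff (r - 1) f + v * psCoeff r f := by
  rcases lt_or_ge r 0 with hr | hr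
  · simp [psCoeff_of_neg hr, psCoeff_of_neg (show r - 1 < 0 by omega)]
  · lift r to ℕ using hr
    have hf : f * (PowerSeries.C u * PowerSeries.X + PowerSeries.C v) =
        PowerSeries.C u * (f * PowerSeries.X) + PowerSeries.C v * f := by ring
    rw [hf]
    cases r with
    | zero => simp [psCoeff]
    | succ k => simp [psCoeff, PowerSeries.coeff_succ_mul_X, show (0 : ℤ) ≤ k + 1 by omega]

theorem polCoeff_mul_linear (r : ℤ) (p : Polynomial K₂) (u v : K₂) :
    polCoeff r (p * (Polynomial.C u * Polynomial.X - Polynomial.C v)) =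
      u * polCoeff (r - 1) p - v * polCoeff r p := by
  rcases lt_or_ge r 0 with hr | hr
  · simp [polCoeff_of_neg hr, polCoeff_of_neg (show r - 1 < 0 by omega)]
  · lift r to ℕ using hr
    have hp : p * (Polynomial.C u * Polynomial.X - Polynomial.C v) =
        Polynomial.C u * (p * Polynomial.X) - Polynomial.C v * p := by ring
    rw [hp]
    cases r with
    | zero => simp [polCoeff]
    | succ k => simp [polCoeff, Polynomial.coeff_mul_X, show (0 : ℤ) ≤ k + 1 by omega]

theorem P_inv_succ_mul (n : ℕ) :
    (P (n + 1))⁻¹ * (PowerSeries.C tv * PowerSeries.X + PowerSeries.C ((n : K₂) + 1)) =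
      (P n)⁻¹ := by
  have hn : PowerSeries.constantCoeff
      (PowerSeries.C tv * PowerSeries.X + PowerSeries.C ((n : K₂) + 1)) ≠ 0 := by
    simpa using Nat.cast_add_one_ne_zero n
  rw [P, Finset.prod_range_succ, ← P, PowerSeries.mul_inv_rev, mul_right_comm,
    PowerSeries.inv_mul_cancel _ hn, one_mul]

theorem psCoeff_P_inv_succ (n : ℕ) (r : ℤ) :
    tv * psCoeff (r - 1) (P (n + 1))⁻¹ + ((n : K₂) + 1) * psCoeff r (P (n + 1))⁻¹ =
      psCoeff r (P n)⁻¹ := by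
  rw [← psCoeff_mul_linear, P_inv_succ_mul]

theorem polCoeff_Q_succ (n : ℕ) (r : ℤ) :
    polCoeff r (Q (n + 1)) = tv * polCoeff (r - 1) (Q n) - n * polCoeff r (Q n) := by
  rw [← polCoeff_mul_linear, Q, Finset.prod_range_succ, ← Q]

theorem P_zero_inv : (P 0)⁻¹ = 1 := by simp [P]

theorem Q_zero : Q 0 = 1 := by simp [Q]

theorem polCoeff_Q_of_lt (n : ℕ) : ∀ r : ℤ, n < r → polCoeff r (Q n) = 0 := by
  induction n with
  | zero => intro r hr; rw [Q_zero, polCoeff_one, if_neg (by omega)]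
  | succ n ih =>
    intro r hr
    push_cast at hr
    rw [polCoeff_Q_succ, ih _ (by omega), ih _ (by omega), mul_zero, mul_zero, sub_zero]

theorem polCoeff_Q_self (n : ℕ) : polCoeff n (Q n) = tv ^ n := by
  induction n with
  | zero => simp [Q_zero, polCoeff_one]
  | succ n ih =>
    rw [polCoeff_Q_succ, Nat.cast_succ, polCoeff_Q_of_lt n (n + 1) (by omega),
      add_sub_cancel_right, ih, pow_succ', mul_zero, sub_zero]

theorem term₁_of_lt {a : ℤ} (b : ℤ) {n : ℕ} (h : a < n) : term₁ a b n = 0 := by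
  rw [term₁, psCoeff_of_neg (by omega), mul_zero, zero_mul]

theorem term₂_eq_term₁_swap (a b : ℤ) : term₂ a b = term₁ b a := rfl

theorem finsum_term₁_eq_sum_range {a : ℤ} (b : ℤ) {N : ℕ} (h : a < N) :
    ∑ᶠ n, term₁ a b n = ∑ n ∈ Finset.range N, term₁ a b n := by
  refine finsum_eq_sum_of_support_subset _ fun n hn => ?_
  by_contra hN
  simp only [Finset.coe_range, Set.mem_Iio, not_lt] at hN
  exact hn (term₁_of_lt b (by omega))

/-- One half of the statement that `(z + w) · Σ n (z/w)^n / ((1+tz)_n (1+tw)_{-n})` vanishes: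
the sum over `n ≥ 1` contributes the boundary term `t z w`. -/
theorem finsum_term₁_add_finsum_term₁ (a b : ℤ) :
    (∑ᶠ n, term₁ a (b - 1) n) + ∑ᶠ n, term₁ (a - 1) b n =
      if a = 1 ∧ b = 1 then tv else 0 := by
  let U (n : ℕ) : K₂ := psCoeff (a - 1 - n) (P n)⁻¹ * polCoeff (b - 1 + n) (Q n)
  have step (n : ℕ) :
      term₁ a (b - 1) (n + 1) + term₁ (a - 1) b n = tv * U n - tv * U (n + 1) := by
    have hp := psCoeff_P_inv_succ n (a - 1 - n)
    have hq := polCoeff_Q_succ n (b + n)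
    simp only [term₁, U, Nat.cast_add, Nat.cast_one]
    rw [show a - ((n : ℤ) + 1) = a - 1 - n by ring,
      show b - 1 + ((n : ℤ) + 1) = b + n by ring,
      show a - 1 - ((n : ℤ) + 1) = a - 1 - n - 1 by ring,
      show b - 1 + (n : ℤ) = b + n - 1 by ring]
    linear_combination polCoeff (b + n) (Q (n + 1)) * hp + psCoeff (a - 1 - n) (P n)⁻¹ * hq
  obtain ⟨N, hN⟩ : ∃ N : ℕ, a < N := ⟨a.toNat + 1, by omega⟩
  have hU : U N = 0 := by simp only [U]; rw [psCoeff_of_neg (by omega), zero_mul]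
  have h₀ : term₁ a (b - 1) 0 = 0 := by simp [term₁]
  rw [finsum_term₁_eq_sum_range (N := N + 1) _ (by push_cast; omega),
    finsum_term₁_eq_sum_range (N := N) _ (by omega), Finset.sum_range_succ', h₀, add_zero,
    ← Finset.sum_add_distrib, Finset.sum_congr rfl fun n _ => step n,
    Finset.sum_range_sub' (fun n => tv * U n), hU, mul_zero, sub_zero]
  simp only [U, P_zero_inv, Q_zero, psCoeff_one, polCoeff_one, Nat.cast_zero, sub_zero, add_zero,
    sub_eq_zero]
  split_ifs <;> simp_all

theorem c_sub_one_right (a b : ℤ) : c a (b - 1) = -c (a - 1) b := by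
  have h₁ := finsum_term₁_add_finsum_term₁ a b
  have h₂ := finsum_term₁_add_finsum_term₁ b a
  simp only [and_comm (a := b = 1)] at h₂
  simp only [c, term₂_eq_term₁_swap]
  linear_combination h₁ - h₂

theorem c_zero_right (a : ℤ) : c a 0 = if a = 1 then tv else 0 := by
  let V (n : ℕ) : K₂ := tv ^ (n + 1) * psCoeff (a - 1 - n) (P n)⁻¹
  have step (n : ℕ) : term₁ a 0 (n + 1) = V n - V (n + 1) := by
    have hp := psCoeff_P_inv_succ n (a - 1 - n)
    simp only [term₁, V, zero_add, polCoeff_Q_self]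
    push_cast
    rw [show a - ((n : ℤ) + 1) = a - 1 - n by ring,
      show a - 1 - ((n : ℤ) + 1) = a - 1 - n - 1 by ring]
    linear_combination tv ^ (n + 1) * hp
  obtain ⟨N, hN⟩ : ∃ N : ℕ, a < N := ⟨a.toNat + 1, by omega⟩
  have hV : V N = 0 := by simp only [V]; rw [psCoeff_of_neg (by omega), mul_zero]
  have h₀ (x y : ℤ) : term₁ x y 0 = 0 := by simp [term₁]
  rw [c, term₂_eq_term₁_swap, finsum_term₁_eq_sum_range (a := 0) (N := 1) _ (by norm_num),
    finsum_term₁_eq_sum_range (N := N + 1) _ (by push_cast; omega), Finset.sum_range_succ',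
    Finset.sum_congr rfl fun n _ => step n, Finset.sum_range_sub', hV, Finset.sum_range_one,
    h₀, h₀]
  simp [V, P_zero_inv, psCoeff_one, sub_eq_zero]

theorem c_eq_neg_one_zpow_mul (a b : ℤ) : c a b = (-1) ^ b * c (a + b) 0 := by
  induction b using Int.induction_on generalizing a with
  | zero => simp
  | succ k ih =>
    have h := c_sub_one_right (a + 1) (k + 1)
    rw [add_sub_cancel_right, add_sub_cancel_right, ih] at h
    rw [zpow_add_one₀ (by norm_num), show a + ((k : ℤ) + 1) = a + 1 + k by ring]
    linear_combination h
  | pred k ih =>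
    rw [c_sub_one_right, ih, zpow_sub_one₀ (by norm_num), inv_neg_one,
      show a + (-(k : ℤ) - 1) = a - 1 + -k by ring]
    ring

/-- All but finitely many terms of each sum vanish (no nonzero terms with
`n > a`, resp. `m > b`), and `c_{a,b} = (−1)^{a−1} t` if `a + b = 1`, and `0`
otherwise. -/
theorem distribution_identity (a b : ℤ) :
    (∀ n : ℕ, a < (n : ℤ) → term₁ a b n = 0) ∧
    (∀ m : ℕ, b < (m : ℤ) → term₂ a b m = 0) ∧
    c a b = if a + b = 1 then (-1 : K₂) ^ (a - 1) * tv else 0 := by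
  refine ⟨fun n => term₁_of_lt b, fun m => term₁_of_lt a, ?_⟩
  rw [c_eq_neg_one_zpow_mul, c_zero_right]
  split_ifs with h
  · rw [show b = -(a - 1) by omega, zpow_neg, ← inv_zpow, inv_neg_one]
  · rw [mul_zero]

end
end

section
/- For a nonzero parameter value of θ, let w_θ ∈ ℚ(θ, y)[[x]] denote the unique formal power series with constant term y satisfying w_θ · exp(w_θ − y) = y · exp(−x/θ). Then the solutions for θ and −θ are mutually inverse in the following sense: substituting y ↦ w_θ(x) into the coefficients of w_{−θ} (a legitimate substitution of a power series with constant term y into rational functions of y, performed in ℚ(θ, y)[[x]]) returns the series y; that is, w_{−θ}(x)|_{y → w_θ(x)} = y. -/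
/-!
STATEMENT 6: the θ ↦ −θ involution property of the formal Lambert-function
solution: `w_{−θ}(x)|_{y → w_θ(x)} = y`.

Here `w_θ ∈ K[[x]]`, `K = ℚ(θ, y)`, is the unique power series with constant
term `y` satisfying `w_θ · exp(w_θ − y) = y · exp(−x/θ)`, and similarly `w_{−θ}`
with `exp(+x/θ)` on the right-hand side.

The substitution `y ↦ w_θ(x)` into the coefficients of `w_{−θ}` is performed by
the (unique) ring homomorphism `Φ : K → K[[x]]` with `Φ(θ) = θ` and
`Φ(y) = w_θ`; applying `Φ` to the coefficient of `x^k` of `w_{−θ}` yields a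
power series of the form `Φ(c_k) · x^k`, and the total sum is the power series
whose coefficient of `x^m` is the finite sum `Σ_{k ≤ m} [x^{m−k}] Φ(c_k)`.
-/

noncomputable section

abbrev K₆ : Type := FractionRing (MvPolynomial (Fin 2) ℚ)

def θv : K₆ := algebraMap (MvPolynomial (Fin 2) ℚ) K₆ (MvPolynomial.X 0)
def yv : K₆ := algebraMap (MvPolynomial (Fin 2) ℚ) K₆ (MvPolynomial.X 1)

/-- Exponential of a formal power series: for `f` with zero constant term,
`exp f = Σ_k f^k / k!`; the coefficient of `x^m` receives contributions only
from `k ≤ m`, so it is given by the finite sum below. -/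
def expS {L : Type*} [Field L] [CharZero L] (f : PowerSeries L) : PowerSeries L :=
  PowerSeries.mk fun m =>
    ∑ k ∈ Finset.range (m + 1), ((k.factorial : L))⁻¹ * PowerSeries.coeff m (f ^ k)

namespace PowerSeries

section CoeffSubst

variable {R S : Type*} [CommRing R] [CommRing S]

/-- Evaluating a polynomial at `X`, with coefficients mapped into `S⟦X⟧`, does not lower its
order of vanishing. -/
theorem X_pow_dvd_eval₂ (φ : R →+* S⟦X⟧) {N : ℕ} {p : Polynomial R}
    (hp : trunc N (p : R⟦X⟧) = 0) : X ^ N ∣ p.eval₂ φ X := by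
  have h : Polynomial.X ^ N ∣ p := by
    rw [Polynomial.X_pow_dvd_iff]
    intro d hd
    have := congrArg (fun q => Polynomial.coeff q d) hp
    simpa [coeff_trunc, hd] using this
  obtain ⟨q, rfl⟩ := h
  simp [Polynomial.eval₂_mul, Polynomial.eval₂_X_pow]

/-- The diagonal sum `∑ k, φ (coeff k f) * X ^ k`. -/
def coeffSubstFun (φ : R →+* S⟦X⟧) (f : R⟦X⟧) : S⟦X⟧ :=
  mk fun m => ∑ k ∈ Finset.range (m + 1), coeff (m - k) (φ (coeff k f))

theorem X_pow_dvd_coeffSubstFun_sub (φ : R →+* S⟦X⟧) (f : R⟦X⟧) (N : ℕ) :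
    X ^ N ∣ coeffSubstFun φ f - (trunc N f).eval₂ φ X := by
  rw [X_pow_dvd_iff]
  intro m hm
  rw [map_sub, sub_eq_zero, eval₂_trunc_eq_sum_range, map_sum, coeffSubstFun, coeff_mk]
  simp only [coeff_mul_X_pow']
  rw [← Finset.sum_filter]
  refine Finset.sum_congr ?_ fun _ _ => rfl
  ext k
  simp only [Finset.mem_range, Finset.mem_filter]
  omega

theorem eq_of_forall_X_pow_dvd_sub {f g : R⟦X⟧} (h : ∀ N, X ^ N ∣ f - g) : f = g := by
  ext n
  have := X_pow_dvd_iff.1 (h (n + 1)) n n.lt_succ_self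
  rwa [map_sub, sub_eq_zero] at this

theorem coeffSubstFun_coe (φ : R →+* S⟦X⟧) (p : Polynomial R) :
    coeffSubstFun φ (p : R⟦X⟧) = p.eval₂ φ X := by
  refine eq_of_forall_X_pow_dvd_sub fun N => ?_
  have h₁ := X_pow_dvd_coeffSubstFun_sub φ (p : R⟦X⟧) N
  have h₂ : X ^ N ∣ (trunc N (p : R⟦X⟧) - p).eval₂ φ X :=
    X_pow_dvd_eval₂ φ (by rw [Polynomial.coe_sub, trunc_sub, trunc_trunc, sub_self])
  rw [Polynomial.eval₂_sub] at h₂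
  simpa using dvd_add h₁ h₂

theorem coeffSubstFun_add (φ : R →+* S⟦X⟧) (f g : R⟦X⟧) :
    coeffSubstFun φ (f + g) = coeffSubstFun φ f + coeffSubstFun φ g := by
  ext m
  simp [coeffSubstFun, Finset.sum_add_distrib]

theorem coeffSubstFun_mul (φ : R →+* S⟦X⟧) (f g : R⟦X⟧) :
    coeffSubstFun φ (f * g) = coeffSubstFun φ f * coeffSubstFun φ g := by
  refine eq_of_forall_X_pow_dvd_sub fun N => ?_
  have h₁ := X_pow_dvd_coeffSubstFun_sub φ (f * g) N
  have h₂ : X ^ N ∣ (trunc N (f * g) - trunc N f * trunc N g).eval₂ φ X :=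
    X_pow_dvd_eval₂ φ (by
      rw [Polynomial.coe_sub, trunc_sub, trunc_trunc, Polynomial.coe_mul, trunc_trunc_mul_trunc,
        sub_self])
  rw [Polynomial.eval₂_sub, Polynomial.eval₂_mul] at h₂
  have h₃ := (X_pow_dvd_coeffSubstFun_sub φ f N).mul_right (coeffSubstFun φ g)
  have h₄ := (X_pow_dvd_coeffSubstFun_sub φ g N).mul_left ((trunc N f).eval₂ φ X)
  convert dvd_sub (dvd_sub (dvd_add h₁ h₂) h₃) h₄ using 1
  ring

/-- The ring homomorphism `R⟦X⟧ → S⟦X⟧` fixing `X` and acting on the coefficients by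
`φ : R → S⟦X⟧`. -/
def coeffSubst (φ : R →+* S⟦X⟧) : R⟦X⟧ →+* S⟦X⟧ where
  toFun := coeffSubstFun φ
  map_one' := by simpa using coeffSubstFun_coe φ 1
  map_mul' := coeffSubstFun_mul φ
  map_zero' := by simpa using coeffSubstFun_coe φ 0
  map_add' := coeffSubstFun_add φ

theorem coeffSubst_apply (φ : R →+* S⟦X⟧) (f : R⟦X⟧) : coeffSubst φ f = coeffSubstFun φ f := rfl

theorem coeffSubst_C (φ : R →+* S⟦X⟧) (a : R) : coeffSubst φ (C a) = φ a := by
  simpa [coeffSubst_apply] using coeffSubstFun_coe φ (Polynomial.C a)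

theorem coeffSubst_X (φ : R →+* S⟦X⟧) : coeffSubst φ X = X := by
  simpa [coeffSubst_apply] using coeffSubstFun_coe φ Polynomial.X

theorem constantCoeff_coeffSubst (φ : R →+* S⟦X⟧) (f : R⟦X⟧) :
    constantCoeff (coeffSubst φ f) = constantCoeff (φ (constantCoeff f)) := by
  rw [← coeff_zero_eq_constantCoeff_apply]
  simp [coeffSubst, coeffSubstFun]

end CoeffSubst

section Exp

variable {L : Type*} [Field L] [CharZero L]

theorem X_pow_dvd_expS_sub {f : L⟦X⟧} (hf : constantCoeff f = 0) (N : ℕ) :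
    X ^ N ∣ expS f - ∑ k ∈ Finset.range N, C ((k.factorial : L))⁻¹ * f ^ k := by
  rw [X_pow_dvd_iff]
  intro m hm
  rw [map_sub, sub_eq_zero, map_sum, expS, coeff_mk]
  simp only [coeff_C_mul]
  refine Finset.sum_subset (by simpa using hm) fun k _ hk => ?_
  have hk' : m < k := by simpa using hk
  have : X ^ k ∣ f ^ k := pow_dvd_pow_of_dvd (X_dvd_iff.2 hf) k
  rw [X_pow_dvd_iff.1 this m hk', mul_zero]

theorem constantCoeff_expS (f : L⟦X⟧) : constantCoeff (expS f) = 1 := by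
  rw [← coeff_zero_eq_constantCoeff_apply]
  simp [expS]

theorem expS_ne_zero (f : L⟦X⟧) : expS f ≠ 0 := fun h => by
  simpa [h] using constantCoeff_expS f

theorem derivative_expS {f : L⟦X⟧} (hf : constantCoeff f = 0) :
    d⁄dX L (expS f) = d⁄dX L f * expS f := by
  have hsum (N : ℕ) :
      d⁄dX L (∑ k ∈ Finset.range (N + 1), C ((k.factorial : L))⁻¹ * f ^ k) =
        d⁄dX L f * ∑ k ∈ Finset.range N, C ((k.factorial : L))⁻¹ * f ^ k := by
    rw [Finset.sum_range_succ', map_add, map_sum, Finset.mul_sum]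
    simp only [pow_zero, mul_one, derivative_C, add_zero]
    refine Finset.sum_congr rfl fun k _ => ?_
    have hk : (C ((k + 1).factorial : L)⁻¹ : L⟦X⟧) * ((k + 1 : ℕ) : L⟦X⟧) =
        C (k.factorial : L)⁻¹ := by
      rw [← map_natCast (C (R := L)), ← map_mul, Nat.factorial_succ]
      congr 1
      have h₁ : ((k + 1 : ℕ) : L) ≠ 0 := Nat.cast_ne_zero.2 k.succ_ne_zero
      have h₂ : (k.factorial : L) ≠ 0 := Nat.cast_ne_zero.2 k.factorial_ne_zero
      rw [Nat.cast_mul]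
      field_simp
    rw [Derivation.leibniz, derivative_C, derivative_pow, Nat.add_sub_cancel, ← hk]
    simp only [smul_eq_mul, mul_zero, add_zero]
    ring
  ext n
  have h₁ := X_pow_dvd_iff.1 (X_pow_dvd_expS_sub hf (n + 2)) (n + 1) (by omega)
  have h₂ := X_pow_dvd_iff.1 ((X_pow_dvd_expS_sub hf (n + 1)).mul_left (d⁄dX L f)) n (by omega)
  rw [map_sub, sub_eq_zero] at h₁
  rw [mul_sub, map_sub, sub_eq_zero, ← hsum] at h₂
  rw [h₂, coeff_derivative, coeff_derivative, h₁]

theorem coeffSubst_expS {K : Type*} [Field K] [CharZero K] (φ : K →+* L⟦X⟧) {f : K⟦X⟧}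
    (hf : constantCoeff f = 0) : coeffSubst φ (expS f) = expS (coeffSubst φ f) := by
  refine eq_of_forall_X_pow_dvd_sub fun N => ?_
  have hf' : constantCoeff (coeffSubst φ f) = 0 := by simp [constantCoeff_coeffSubst, hf]
  have h₁ := map_dvd (coeffSubst φ) (X_pow_dvd_expS_sub hf N)
  have h₂ := X_pow_dvd_expS_sub hf' N
  have hinv (n : ℕ) (hn : n ≠ 0) : φ ((n : K)⁻¹) = C ((n : L)⁻¹) := by
    have hn' : (C (n : L) : L⟦X⟧) ≠ 0 :=
      (map_ne_zero_iff _ C_injective).2 (Nat.cast_ne_zero.2 hn)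
    apply mul_left_cancel₀ hn'
    rw [← map_mul, mul_inv_cancel₀ (Nat.cast_ne_zero.2 hn), map_one, map_natCast,
      ← map_natCast φ, ← map_mul, mul_inv_cancel₀ (Nat.cast_ne_zero.2 hn), map_one]
  simp only [map_pow, coeffSubst_X, map_sub, map_sum, map_mul, coeffSubst_C,
    hinv _ (Nat.factorial_ne_zero _)] at h₁
  simpa using dvd_sub h₁ h₂

/-- If `w * exp (w - y) = y * exp a` and `v * exp (v - w) = w * exp b` with `a + b = 0`,
then `v` is constant. -/
theorem eq_C_of_lambert {v w a b : L⟦X⟧} {y : L} (hy : y ≠ 0) (hy₁ : 1 + y ≠ 0)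
    (hv₀ : constantCoeff v = y) (hw₀ : constantCoeff w = y)
    (ha₀ : constantCoeff a = 0) (hb₀ : constantCoeff b = 0) (hab : a + b = 0)
    (hw : w * expS (w - C y) = C y * expS a) (hv : v * expS (v - w) = w * expS b) :
    v = C y := by
  have dw := congrArg (d⁄dX L) hw
  have dv := congrArg (d⁄dX L) hv
  have dab := congrArg (d⁄dX L) hab
  simp only [Derivation.leibniz, smul_eq_mul, map_sub, map_add, map_zero, derivative_C,
    derivative_expS (show constantCoeff (w - C y) = 0 by simp [hw₀]),
    derivative_expS (show constantCoeff (v - w) = 0 by simp [hv₀, hw₀]),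
    derivative_expS ha₀, derivative_expS hb₀, sub_zero, mul_zero, add_zero] at dw dv dab
  have hw' : d⁄dX L w + w * d⁄dX L w = d⁄dX L a * w := by
    apply mul_left_cancel₀ (expS_ne_zero (w - C y))
    linear_combination dw - d⁄dX L a * hw
  have hv' : w * d⁄dX L v + w * v * (d⁄dX L v - d⁄dX L w) =
      v * d⁄dX L w + w * v * d⁄dX L b := by
    apply mul_left_cancel₀ (expS_ne_zero (v - w))
    linear_combination w * dv - (d⁄dX L w + w * d⁄dX L b) * hv
  have hmul : (w * (1 + v)) * d⁄dX L v = 0 := by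
    linear_combination hv' + v * hw' + w * v * dab
  have hne : w * (1 + v) ≠ 0 := fun h => by
    have := congrArg constantCoeff h
    simp [hw₀, hv₀, hy, hy₁] at this
  refine derivative.ext ?_ (by simp [hv₀])
  rw [(mul_eq_zero.1 hmul).resolve_left hne, derivative_C]

end Exp

end PowerSeries

theorem θv_ne_zero : θv ≠ 0 := by
  simp [θv]

theorem yv_ne_zero : yv ≠ 0 := by
  simp [yv]

theorem one_add_yv_ne_zero : 1 + yv ≠ 0 := by
  intro h
  have h' : (1 + MvPolynomial.X 1 : MvPolynomial (Fin 2) ℚ) = 0 :=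
    IsFractionRing.injective (MvPolynomial (Fin 2) ℚ) K₆ (by simpa [yv] using h)
  simpa using congrArg MvPolynomial.constantCoeff h'

open PowerSeries in
theorem lambert_involution
    (Wp Wm : PowerSeries K₆)
    (hWp₀ : constantCoeff Wp = yv)
    (hWp : Wp * expS (Wp - C yv) = C yv * expS (C (-θv⁻¹) * X))
    (hWm₀ : constantCoeff Wm = yv)
    (hWm : Wm * expS (Wm - C yv) = C yv * expS (C θv⁻¹ * X))
    (Φ : K₆ →+* PowerSeries K₆)
    (hΦθ : Φ θv = C θv) (hΦy : Φ yv = Wp) :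
    (PowerSeries.mk fun m =>
        ∑ k ∈ Finset.range (m + 1), coeff (m - k) (Φ (coeff k Wm)))
      = C yv := by
  have hinv : Φ θv⁻¹ = C θv⁻¹ := by
    have hθ : (C θv : PowerSeries K₆) ≠ 0 := by simpa using θv_ne_zero
    apply mul_left_cancel₀ hθ
    rw [← map_mul, mul_inv_cancel₀ θv_ne_zero, map_one, ← hΦθ, ← map_mul,
      mul_inv_cancel₀ θv_ne_zero, map_one]
  have hV := congrArg (coeffSubst Φ) hWm
  rw [map_mul, map_mul, coeffSubst_expS Φ (by simp [hWm₀]), coeffSubst_expS Φ (by simp), map_sub,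
    map_mul, coeffSubst_C, coeffSubst_C, coeffSubst_X, hΦy, hinv] at hV
  change coeffSubst Φ Wm = C yv
  exact eq_C_of_lambert yv_ne_zero one_add_yv_ne_zero
    (by rw [constantCoeff_coeffSubst, hWm₀, hΦy, hWp₀]) hWp₀ (by simp) (by simp)
    (by rw [← add_mul, ← map_add, neg_add_cancel, map_zero, zero_mul]) hWp hV

end
end
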